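/- For all real numbers a, b > 0 with a ≠ b and every real α ≤ 1/2, one has H_α ≤ H_{1/2} < (2G + A)/3 < X. -/

import Mathlib

open Real

/-- Arithmetic mean -/
noncomputable def Am (a b : ℝ) : ℝ := (a + b) / 2

/-- Geometric mean -/
noncomputable def Gm (a b : ℝ) : ℝ := Real.sqrt (a * b)

/-- Harmonic mean -/
noncomputable def Hm (a b : ℝ) : ℝ := 2 * a * b / (a + b)

/-- Seiffert mean -/
noncomputable def Pm (a b : ℝ) : ℝ := (a - b) / (2 * Real.arcsin ((a - b) / (a + b)))

/-- Sándor's X mean -/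
noncomputable def Xm (a b : ℝ) : ℝ := Am a b * Real.exp (Gm a b / Pm a b - 1)

/-- Logarithmic mean -/
noncomputable def Lm (a b : ℝ) : ℝ := (a - b) / (Real.log a - Real.log b)

/-- Identric mean -/
noncomputable def Im (a b : ℝ) : ℝ := (1 / Real.exp 1) * ((a ^ a) / (b ^ b)) ^ (1 / (a - b))

/-- Power mean -/
noncomputable def Mp (p a b : ℝ) : ℝ :=
  if p = 0 then Real.sqrt (a * b) else ((a ^ p + b ^ p) / 2) ^ (1 / p)

/-- Power-type Heronian mean -/
noncomputable def Hp (p a b : ℝ) : ℝ :=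
  if p = 0 then Real.sqrt (a * b) else ((a ^ p + (a * b) ^ (p / 2) + b ^ p) / 3) ^ (1 / p)

lemma hasDerivAt_sin_mul_cos_sub_add {t : ℝ} (h : 1 + 2 * cos t ≠ 0) :
    HasDerivAt (fun x => sin x * cos x - x + 2 * sin x ^ 3 / (1 + 2 * cos x))
      (sin t ^ 2 * (2 - 2 * cos t) / (1 + 2 * cos t) ^ 2) t := by
  have hs := Real.hasDerivAt_sin t
  have hc := Real.hasDerivAt_cos t
  have hd : HasDerivAt (fun x => 1 + 2 * cos x) (2 * -sin t) t := (hc.const_mul 2).const_add 1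
  refine (((hs.mul hc).sub (hasDerivAt_id t)).add
    (((hs.pow 3).const_mul 2).div hd h)).congr_deriv ?_
  simp only [Pi.pow_apply]
  have h' : 1 + cos t * 2 ≠ 0 := by rwa [mul_comm]
  push_cast
  field_simp
  have h2 : sin t ^ 2 = 1 - cos t ^ 2 := Real.sin_sq t
  have h4 : sin t ^ 4 = (1 - cos t ^ 2) ^ 2 := by rw [← h2]; ring
  ring_nf
  simp only [h2, h4]
  ring

lemma sin_mul_cos_sub_add_pos {t : ℝ} (h0 : 0 < t) (h1 : t < π / 2) :
    0 < sin t * cos t - t + 2 * sin t ^ 3 / (1 + 2 * cos t) := by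
  have hpos : ∀ x ∈ Set.Icc 0 t, 0 < 1 + 2 * cos x := fun x hx => by
    have := Real.cos_pos_of_mem_Ioo (x := x) ⟨by linarith [hx.1, pi_pos], by linarith [hx.2]⟩
    linarith
  have hmono : StrictMonoOn
      (fun x => sin x * cos x - x + 2 * sin x ^ 3 / (1 + 2 * cos x)) (Set.Icc 0 t) := by
    refine strictMonoOn_of_deriv_pos (convex_Icc 0 t) (fun x hx =>
      (hasDerivAt_sin_mul_cos_sub_add (hpos x hx).ne').continuousAt.continuousWithinAt) ?_
    intro x hx
    rw [interior_Icc] at hx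
    have hx' := hpos x (Set.Ioo_subset_Icc_self hx)
    rw [(hasDerivAt_sin_mul_cos_sub_add hx'.ne').deriv]
    have hs : 0 < sin x := Real.sin_pos_of_pos_of_lt_pi hx.1 (by linarith [hx.2, pi_pos])
    have hc : cos x < 1 := by
      have := Real.sin_sq_add_cos_sq x
      nlinarith
    have : 0 < 2 - 2 * cos x := by linarith
    positivity
  have := hmono ⟨le_rfl, h0.le⟩ ⟨h0.le, le_rfl⟩ h0
  simpa using this

lemma one_add_two_mul_cos_lt_exp {t : ℝ} (h0 : 0 < t) (h1 : t < π / 2) :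
    (1 + 2 * cos t) / 3 < exp (t * cos t / sin t - 1) := by
  have hpos : ∀ x ∈ Set.Icc 0 t, 0 < 1 + 2 * cos x := fun x hx => by
    have := Real.cos_pos_of_mem_Ioo (x := x) ⟨by linarith [hx.1, pi_pos], by linarith [hx.2]⟩
    linarith
  have hsin : ∀ x, 0 < x → x ≤ t → 0 < sin x := fun x hx hxt =>
    Real.sin_pos_of_pos_of_lt_pi hx (by linarith [pi_pos])
  have hmono : StrictMonoOn
      (fun x => cos x / sinc x - 1 - log ((1 + 2 * cos x) / 3)) (Set.Icc 0 t) := by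
    refine strictMonoOn_of_deriv_pos (convex_Icc 0 t) ?_ ?_
    · refine ((continuous_cos.continuousOn.div continuous_sinc.continuousOn ?_).sub
        continuousOn_const).sub (ContinuousOn.log (by fun_prop) ?_)
      · intro x hx
        rcases hx.1.eq_or_lt with rfl | hx0
        · simp
        · rw [sinc_of_ne_zero hx0.ne']
          exact (div_pos (hsin x hx0 hx.2) hx0).ne'
      · intro x hx
        have := hpos x hx
        positivity
    · intro x hx
      rw [interior_Icc] at hx
      have hd := hpos x (Set.Ioo_subset_Icc_self hx)
      have hs := hsin x hx.1 hx.2.le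
      have key : HasDerivAt (fun y => y * cos y / sin y - 1 - log ((1 + 2 * cos y) / 3))
          ((sin x * cos x - x + 2 * sin x ^ 3 / (1 + 2 * cos x)) / sin x ^ 2) x := by
        have hl : HasDerivAt (fun y => (1 + 2 * cos y) / 3) (2 * -sin x / 3) x :=
          (((Real.hasDerivAt_cos x).const_mul 2).const_add 1).div_const 3
        refine (((((hasDerivAt_id x).mul (Real.hasDerivAt_cos x)).div
          (Real.hasDerivAt_sin x) hs.ne').sub_const 1).sub
          (hl.log (by positivity))).congr_deriv ?_
        simp only [id, Pi.mul_apply]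
        have h2 : cos x ^ 2 = 1 - sin x ^ 2 := Real.cos_sq' x
        field_simp
        ring_nf
        simp only [h2]
        ring
      have heq : (fun y => cos y / sinc y - 1 - log ((1 + 2 * cos y) / 3)) =ᶠ[nhds x]
          (fun y => y * cos y / sin y - 1 - log ((1 + 2 * cos y) / 3)) := by
        filter_upwards [lt_mem_nhds hx.1] with y hy
        rw [sinc_of_ne_zero hy.ne', div_div_eq_mul_div, mul_comm y]
      rw [(key.congr_of_eventuallyEq heq).deriv]
      have := sin_mul_cos_sub_add_pos hx.1 (hx.2.trans h1)
      positivity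
  have hlt := hmono ⟨le_rfl, h0.le⟩ ⟨h0.le, le_rfl⟩ h0
  have hd := hpos t ⟨h0.le, le_rfl⟩
  have hzero : log ((1 + 2 * (1 : ℝ)) / 3) = 0 := by norm_num
  simp only [cos_zero, sinc_zero, hzero, sinc_of_ne_zero h0.ne', div_div_eq_mul_div] at hlt
  rw [← Real.log_lt_iff_lt_exp (by positivity), mul_comm t]
  linarith

lemma Gm_pos {a b : ℝ} (ha : 0 < a) (hb : 0 < b) : 0 < Gm a b :=
  Real.sqrt_pos.2 (mul_pos ha hb)

lemma Gm_comm (a b : ℝ) : Gm a b = Gm b a := by rw [Gm, Gm, mul_comm]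

lemma Am_comm (a b : ℝ) : Am a b = Am b a := by rw [Am, Am, add_comm]

lemma Pm_comm (a b : ℝ) : Pm a b = Pm b a := by
  rw [Pm, Pm, ← neg_sub b a, add_comm a b, neg_div (b + a), Real.arcsin_neg, mul_neg, neg_div_neg_eq]

lemma Xm_comm (a b : ℝ) : Xm a b = Xm b a := by
  rw [Xm, Xm, Am_comm, Gm_comm, Pm_comm]

lemma two_mul_Gm_add_Am_lt_Xm_of_lt {a b : ℝ} (hb : 0 < b) (hab : b < a) :
    (2 * Gm a b + Am a b) / 3 < Xm a b := by
  have ha : 0 < a := hb.trans hab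
  have hA : 0 < Am a b := by rw [Am]; positivity
  set s := (a - b) / (a + b) with hs
  have hs0 : 0 < s := div_pos (sub_pos.2 hab) (by positivity)
  have hs1 : s < 1 := by rw [hs, div_lt_one (by positivity)]; linarith
  have ht0 : 0 < arcsin s := Real.arcsin_pos.2 hs0
  have hsin : sin (arcsin s) = s := Real.sin_arcsin (by linarith) hs1.le
  have hcos : Gm a b = Am a b * cos (arcsin s) := by
    rw [Gm, Real.cos_arcsin, Real.sqrt_eq_iff_mul_self_eq (by positivity) (by positivity),
      mul_mul_mul_comm, Real.mul_self_sqrt (by nlinarith), hs, Am]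
    field_simp
    ring
  have hP : Gm a b / Pm a b = arcsin s * cos (arcsin s) / sin (arcsin s) := by
    have hsub : a - b ≠ 0 := (sub_pos.2 hab).ne'
    rw [hcos, Pm, ← hs, hsin]
    generalize cos (arcsin s) = c
    generalize arcsin s = t at ht0
    rw [hs, Am]
    field_simp
  rw [Xm, hP, hcos]
  have := mul_lt_mul_of_pos_left
    (one_add_two_mul_cos_lt_exp ht0 (Real.arcsin_lt_pi_div_two.2 hs1)) hA
  linarith

lemma two_mul_Gm_add_Am_lt_Xm {a b : ℝ} (ha : 0 < a) (hb : 0 < b) (hab : a ≠ b) :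
    (2 * Gm a b + Am a b) / 3 < Xm a b := by
  rcases hab.lt_or_gt with h | h
  · rw [Gm_comm, Am_comm, Xm_comm]
    exact two_mul_Gm_add_Am_lt_Xm_of_lt ha h
  · exact two_mul_Gm_add_Am_lt_Xm_of_lt hb h

lemma Hp_half_lt {a b : ℝ} (ha : 0 < a) (hb : 0 < b) (hab : a ≠ b) :
    Hp (1 / 2) a b < (2 * Gm a b + Am a b) / 3 := by
  obtain ⟨x, hx, rfl⟩ : ∃ x : ℝ, 0 < x ∧ x ^ 4 = a :=
    ⟨a ^ (1 / 4 : ℝ), by positivity, by rw [← Real.rpow_mul_natCast ha.le]; norm_num⟩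
  obtain ⟨y, hy, rfl⟩ : ∃ y : ℝ, 0 < y ∧ y ^ 4 = b :=
    ⟨b ^ (1 / 4 : ℝ), by positivity, by rw [← Real.rpow_mul_natCast hb.le]; norm_num⟩
  have hxy : x - y ≠ 0 := fun h => hab (by rw [sub_eq_zero.1 h])
  have h2 : ∀ z : ℝ, 0 < z → (z ^ 4) ^ (1 / 2 : ℝ) = z ^ 2 := fun z hz => by
    rw [← Real.rpow_natCast_mul hz.le, ← Real.rpow_natCast]; norm_num
  have h4 : (x ^ 4 * y ^ 4) ^ ((1 / 2 : ℝ) / 2) = x * y := by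
    rw [← mul_pow, ← Real.rpow_natCast_mul (by positivity)]; norm_num
  have hG : Gm (x ^ 4) (y ^ 4) = x ^ 2 * y ^ 2 := by
    rw [Gm, Real.sqrt_eq_rpow, Real.mul_rpow (by positivity) (by positivity), h2 x hx, h2 y hy]
  rw [Hp, if_neg (by norm_num), h2 x hx, h2 y hy, h4, hG, Am, one_div_one_div, Real.rpow_two]
  have : 0 < (x - y) ^ 4 := by positivity
  nlinarith

lemma Gm_rpow_le_heronian {a b : ℝ} (ha : 0 < a) (hb : 0 < b) (p : ℝ) :
    Gm a b ^ p ≤ (a ^ p + (a * b) ^ (p / 2) + b ^ p) / 3 := by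
  have hG : Gm a b ^ p = a ^ (p / 2) * b ^ (p / 2) := by
    rw [Gm, Real.sqrt_eq_rpow, ← Real.rpow_mul (by positivity), ← Real.mul_rpow ha.le hb.le]
    ring_nf
  have h2 : ∀ z : ℝ, 0 < z → z ^ p = (z ^ (p / 2)) ^ 2 := fun z hz => by
    rw [← Real.rpow_mul_natCast hz.le]; norm_num
  rw [hG, Real.mul_rpow ha.le hb.le, h2 a ha, h2 b hb]
  nlinarith [sq_nonneg (a ^ (p / 2) - b ^ (p / 2))]

lemma Gm_le_Hp {a b p : ℝ} (ha : 0 < a) (hb : 0 < b) (hp : 0 < p) : Gm a b ≤ Hp p a b := by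
  rw [Hp, if_neg hp.ne', one_div, Real.le_rpow_inv_iff_of_pos (Gm_pos ha hb).le (by positivity) hp]
  exact Gm_rpow_le_heronian ha hb p

lemma Hp_le_Gm {a b p : ℝ} (ha : 0 < a) (hb : 0 < b) (hp : p ≤ 0) : Hp p a b ≤ Gm a b := by
  rcases hp.eq_or_lt with rfl | hp
  · rw [Hp, if_pos rfl, Gm]
  · rw [Hp, if_neg hp.ne, one_div, Real.rpow_inv_le_iff_of_neg (by positivity) (Gm_pos ha hb) hp]
    exact Gm_rpow_le_heronian ha hb p

lemma Hp_le_Hp_of_pos {a b p q : ℝ} (ha : 0 < a) (hb : 0 < b) (hp : 0 < p) (hpq : p ≤ q) :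
    Hp p a b ≤ Hp q a b := by
  have hq : 0 < q := hp.trans_le hpq
  have hpow : ∀ z : ℝ, 0 < z → (z ^ p) ^ (q / p) = z ^ q := fun z hz => by
    rw [← Real.rpow_mul hz.le, mul_div_cancel₀ q hp.ne']
  have hmid : ((a * b) ^ (p / 2)) ^ (q / p) = (a * b) ^ (q / 2) := by
    rw [← Real.rpow_mul (by positivity)]
    congr 1
    field_simp
  have jensen := Real.rpow_arith_mean_le_arith_mean_rpow (Finset.univ : Finset (Fin 3))
    (fun _ => 1 / 3) ![a ^ p, (a * b) ^ (p / 2), b ^ p] (by intros; positivity)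
    (by simp) (by intro i _; fin_cases i <;> simp <;> positivity)
    ((one_le_div hp).2 hpq)
  simp only [Fin.sum_univ_three, Matrix.cons_val_zero, Matrix.cons_val_one,
    Matrix.cons_val, hpow a ha, hpow b hb, hmid] at jensen
  rw [Hp, Hp, if_neg hp.ne', if_neg hq.ne', one_div q,
    Real.le_rpow_inv_iff_of_pos (by positivity) (by positivity) hq,
    ← Real.rpow_mul (by positivity), one_div_mul_eq_div]
  convert jensen using 2 <;> ring

lemma Hp_le_Hp_of_le {a b p q : ℝ} (ha : 0 < a) (hb : 0 < b) (hq : 0 < q) (hpq : p ≤ q) :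
    Hp p a b ≤ Hp q a b := by
  rcases le_or_gt p 0 with hp | hp
  · exact (Hp_le_Gm ha hb hp).trans (Gm_le_Hp ha hb hq)
  · exact Hp_le_Hp_of_pos ha hb hp hpq

theorem stmt_7 (a b : ℝ) (ha : 0 < a) (hb : 0 < b) (hab : a ≠ b)
    (α : ℝ) (hα : α ≤ 1 / 2) :
    Hp α a b ≤ Hp (1 / 2) a b ∧
    Hp (1 / 2) a b < (2 * Gm a b + Am a b) / 3 ∧
    (2 * Gm a b + Am a b) / 3 < Xm a b := by
  exact ⟨Hp_le_Hp_of_le ha hb (by norm_num) hα, Hp_half_lt ha hb hab,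
    two_mul_Gm_add_Am_lt_Xm ha hb hab⟩
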